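/- Let G be a group, K a field, and A a finite-dimensional G-graded K-algebra with J^gr(A) = 0. Then A is a unital algebra. -/

import Mathlib

/-!
STATEMENT 1: If `A` is a finite-dimensional `G`-graded algebra over a field with
`J^gr(A) = 0`, then `A` is unital.
-/

universe u v w

variable (F : Type u) [Field F] (G : Type v) [Group G]
variable (A : Type w) [NonUnitalRing A] [Module F A]
  [SMulCommClass F A A] [IsScalarTower F A A]

/-- `𝒜` is a `G`-grading of the (not necessarily unital) `F`-algebra `A`:
`A = ⊕_{g ∈ G} A_g` with `A_g A_h ⊆ A_{gh}`. -/
def IsAlgebraGrading (𝒜 : G → Submodule F A) : Prop :=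
  iSupIndep 𝒜 ∧ (⨆ g, 𝒜 g) = ⊤ ∧
    ∀ ⦃g h : G⦄ ⦃x y : A⦄, x ∈ 𝒜 g → y ∈ 𝒜 h → x * y ∈ 𝒜 (g * h)

/-- A graded right `A`-module: a `G`-graded `F`-vector space `M = ⊕_g M_g` with a
right `A`-action (given as an `F`-bilinear map) satisfying `(m·a)·b = m·(ab)` and
`M_g A_h ⊆ M_{gh}`. -/
structure GradedRightModule (𝒜 : G → Submodule F A) where
  M : Type w
  [acg : AddCommGroup M]
  [mod : Module F M]
  grading : G → Submodule F M
  indep : iSupIndep grading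
  spans : (⨆ g, grading g) = ⊤
  act : M →ₗ[F] A →ₗ[F] M
  act_assoc : ∀ (m : M) (a b : A), act (act m a) b = act m (a * b)
  act_graded : ∀ ⦃g h : G⦄ ⦃m : M⦄ ⦃a : A⦄, m ∈ grading g → a ∈ 𝒜 h →
    act m a ∈ grading (g * h)

attribute [instance] GradedRightModule.acg GradedRightModule.mod

variable {F G A}

/-- A graded submodule of a graded right module. -/
def GradedRightModule.IsGradedSubmodule {𝒜 : G → Submodule F A}
    (V : GradedRightModule F G A 𝒜) (N : Submodule F V.M) : Prop :=
  (∀ m ∈ N, ∀ a : A, V.act m a ∈ N) ∧ N = ⨆ g, N ⊓ V.grading g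

/-- A graded right module is graded simple if `MA ≠ 0` and its only graded
submodules are `0` and `M`. -/
def GradedRightModule.IsGradedSimple {𝒜 : G → Submodule F A}
    (V : GradedRightModule F G A 𝒜) : Prop :=
  (∃ (m : V.M) (a : A), V.act m a ≠ 0) ∧
    ∀ N : Submodule F V.M, V.IsGradedSubmodule N → N = ⊥ ∨ N = ⊤

variable (F G A) in
/-- The graded Jacobson radical: the intersection of the annihilators of all graded
simple right `A`-modules (equal to `A` when there is no such module). -/
def gradedJacobson (𝒜 : G → Submodule F A) : Submodule F A :=
  ⨅ (V : GradedRightModule F G A 𝒜) (_ : V.IsGradedSimple), LinearMap.ker V.act.flip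

/-- A right ideal of `A` that is spanned by its homogeneous elements. -/
structure IsGradedRightIdeal (𝒜 : G → Submodule F A) (I : Submodule F A) : Prop where
  mul_mem : ∀ x ∈ I, ∀ a : A, x * a ∈ I
  le_iSup : I ≤ ⨆ g, I ⊓ 𝒜 g

omit [Group G] [SMulCommClass F A A] [IsScalarTower F A A] in
theorem IsGradedRightIdeal.top {𝒜 : G → Submodule F A} (h𝒜 : (⨆ g, 𝒜 g) = ⊤) :
    IsGradedRightIdeal 𝒜 ⊤ :=
  ⟨fun _ _ _ => Submodule.mem_top, by simp [h𝒜]⟩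

omit [SMulCommClass F A A] [IsScalarTower F A A] in
theorem IsGradedRightIdeal.le_gradedJacobson {𝒜 : G → Submodule F A} {I : Submodule F A}
    (hI : IsGradedRightIdeal 𝒜 I) (hsq : ∀ x ∈ I, ∀ y ∈ I, x * y = 0) :
    I ≤ gradedJacobson F G A 𝒜 := by
  refine le_iInf₂ fun V hV => ?_
  set N := Submodule.map₂ V.act ⊤ I with hN
  have hgraded : V.IsGradedSubmodule N := by
    refine ⟨fun m hm a => ?_, le_antisymm ?_ (iSup_le fun g => inf_le_left)⟩
    · have : N ≤ N.comap (V.act.flip a) := Submodule.map₂_le.2 fun v _ x hx => by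
        simpa [V.act_assoc] using
          Submodule.apply_mem_map₂ V.act (Submodule.mem_top (x := v)) (hI.mul_mem x hx a)
      exact this hm
    · calc N ≤ Submodule.map₂ V.act (⨆ g, V.grading g) (⨆ h, I ⊓ 𝒜 h) :=
            Submodule.map₂_le_map₂ V.spans.ge hI.le_iSup
        _ ≤ ⨆ g, N ⊓ V.grading g := by
            simp only [Submodule.map₂_iSup_left, Submodule.map₂_iSup_right]
            refine iSup_le fun h => iSup_le fun g => le_iSup_of_le (g * h) (le_inf ?_ ?_)
            · exact Submodule.map₂_le_map₂ le_top inf_le_left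
            · exact Submodule.map₂_le.2 fun v hv x hx => V.act_graded hv hx.2
  have hNI : ∀ m ∈ N, ∀ y ∈ I, V.act m y = 0 := fun m hm y hy => by
    have : N ≤ LinearMap.ker (V.act.flip y) := Submodule.map₂_le.2 fun v _ x hx => by
      simp [V.act_assoc, hsq x hx y hy]
    exact this hm
  have hzero : ∀ v, ∀ y ∈ I, V.act v y = 0 := by
    intro v y hy
    rcases hV.2 N hgraded with h | h
    · have := Submodule.apply_mem_map₂ V.act (Submodule.mem_top (x := v)) hy
      rwa [← hN, h, Submodule.mem_bot] at this
    · exact hNI v (h ▸ Submodule.mem_top) y hy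
  exact fun y hy => LinearMap.mem_ker.2 (LinearMap.ext fun v => hzero v y hy)

omit [Group G] [SMulCommClass F A A] [IsScalarTower F A A] in
/-- The kernel of a homogeneous map on a homogeneous subspace is homogeneous. -/
theorem inf_ker_le_iSup_of_homogeneous {𝒜 : G → Submodule F A} (h𝒜 : iSupIndep 𝒜)
    {I : Submodule F A} (hI : I ≤ ⨆ g, I ⊓ 𝒜 g) (φ : A →ₗ[F] A) {σ : G → G}
    (hσ : Function.Injective σ) (hφ : ∀ g, ∀ x ∈ 𝒜 g, φ x ∈ 𝒜 (σ g)) :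
    I ⊓ LinearMap.ker φ ≤ ⨆ g, (I ⊓ LinearMap.ker φ) ⊓ 𝒜 g := by
  rintro z ⟨hzI, hz⟩
  obtain ⟨f, hf, rfl⟩ := (Submodule.mem_iSup_iff_exists_finsupp _ _).1 (hI hzI)
  have hsum : ∑ g ∈ f.support, φ (f g) = 0 := by
    simpa [Finsupp.sum, map_sum] using hz
  have hker : ∀ g ∈ f.support, φ (f g) = 0 :=
    (iSupIndep_iff_finsetSum_eq_zero_imp_eq_zero _).1 (h𝒜.comp hσ) _ _
      (fun g _ => hφ g _ (hf g).2) hsum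
  exact Submodule.sum_mem _ fun g hg =>
    Submodule.mem_iSup_of_mem g ⟨⟨(hf g).1, hker g hg⟩, (hf g).2⟩

omit [IsScalarTower F A A] in
theorem IsGradedRightIdeal.inf_ker_mulLeft {𝒜 : G → Submodule F A}
    (hgr : IsAlgebraGrading F G A 𝒜) {I : Submodule F A} (hI : IsGradedRightIdeal 𝒜 I)
    {g : G} {x : A} (hx : x ∈ 𝒜 g) :
    IsGradedRightIdeal 𝒜 (I ⊓ LinearMap.ker (LinearMap.mulLeft F x)) where
  mul_mem := by
    rintro y ⟨hyI, hy⟩ a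
    have hy : x * y = 0 := hy
    exact ⟨hI.mul_mem y hyI a, by simp [← mul_assoc, hy]⟩
  le_iSup := inf_ker_le_iSup_of_homogeneous hgr.1 hI.le_iSup _ (mul_right_injective g)
    fun _ _ hy => hgr.2.2 hx hy

omit [IsScalarTower F A A] in
theorem IsGradedRightIdeal.map_mulLeft {𝒜 : G → Submodule F A}
    (hgr : IsAlgebraGrading F G A 𝒜) {I : Submodule F A} (hI : IsGradedRightIdeal 𝒜 I)
    {g : G} {x : A} (hx : x ∈ 𝒜 g) :
    IsGradedRightIdeal 𝒜 (I.map (LinearMap.mulLeft F x)) where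
  mul_mem := by
    rintro _ ⟨y, hy, rfl⟩ a
    exact ⟨y * a, hI.mul_mem y hy a, by simp [mul_assoc]⟩
  le_iSup := by
    refine (Submodule.map_mono hI.le_iSup).trans ?_
    rw [Submodule.map_iSup]
    refine iSup_le fun h => le_iSup_of_le (g * h) (le_inf (Submodule.map_mono inf_le_left) ?_)
    rintro _ ⟨y, hy, rfl⟩
    exact hgr.2.2 hx hy.2

omit [IsScalarTower F A A] in
theorem IsGradedRightIdeal.exists_right_unit {𝒜 : G → Submodule F A}
    (hgr : IsAlgebraGrading F G A 𝒜) {I : Submodule F A} (hI : IsGradedRightIdeal 𝒜 I)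
    {g : G} {x : A} (hx : x ∈ 𝒜 g) (hxI : x ∈ I.map (LinearMap.mulLeft F x)) :
    ∃ y ∈ I, y ∈ 𝒜 1 ∧ x * y = x := by
  obtain ⟨z, hz, hxz⟩ := hxI
  have hxz : x * z = x := hxz
  have hz' := hI.le_iSup hz
  rw [iSup_split_single _ (1 : G)] at hz'
  obtain ⟨y, hy, w, hw, rfl⟩ := Submodule.mem_sup.1 hz'
  refine ⟨y, hy.1, hy.2, ?_⟩
  have hxy : x * y ∈ 𝒜 g := by simpa using hgr.2.2 hx hy.2
  have hle : (⨆ (h : G) (_ : h ≠ 1), I ⊓ 𝒜 h) ≤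
      (⨆ (k : G) (_ : k ≠ g), 𝒜 k).comap (LinearMap.mulLeft F x) := by
    refine iSup₂_le fun h hh v hv => ?_
    exact Submodule.mem_iSup_of_mem (g * h)
      (Submodule.mem_iSup_of_mem (by simpa using hh) (hgr.2.2 hx hv.2))
  have hxw : x * w = x - x * y := by
    rw [eq_sub_iff_add_eq, add_comm, ← mul_add, hxz]
  have h0 : x - x * y = 0 :=
    Submodule.disjoint_def.1 (hgr.1 g) _ (sub_mem hx hxy) (hxw ▸ hle hw)
  exact (sub_eq_zero.1 h0).symm

theorem IsGradedRightIdeal.exists_idempotent {𝒜 : G → Submodule F A}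
    (hgr : IsAlgebraGrading F G A 𝒜) [FiniteDimensional F A]
    (hJ : gradedJacobson F G A 𝒜 = ⊥) {R : Submodule F A} (hR : IsGradedRightIdeal 𝒜 R)
    (hR0 : R ≠ ⊥) : ∃ y ∈ R, y ∈ 𝒜 1 ∧ y ≠ 0 ∧ y * y = y := by
  obtain ⟨I, ⟨hI, hI0, hIR⟩, hmin⟩ := wellFounded_lt.has_min
    {I : Submodule F A | IsGradedRightIdeal 𝒜 I ∧ I ≠ ⊥ ∧ I ≤ R} ⟨R, hR, hR0, le_rfl⟩
  have hbot : ∀ K, IsGradedRightIdeal 𝒜 K → K < I → K = ⊥ := fun K hK hlt => by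
    by_contra h
    exact hmin K ⟨hK, h, hlt.le.trans hIR⟩ hlt
  obtain ⟨g, x, hx, z, hzI, hxz⟩ :
      ∃ g, ∃ x ∈ I ⊓ 𝒜 g, ∃ z ∈ I, x * z ≠ 0 := by
    by_contra! h
    refine hI0 (le_bot_iff.1 (hJ ▸ hI.le_gradedJacobson fun x hx y hy => ?_))
    have : I ≤ LinearMap.ker (LinearMap.mulRight F y) :=
      hI.le_iSup.trans (iSup_le fun g x hx => h g x hx y hy)
    exact this hx
  have hmap : I.map (LinearMap.mulLeft F x) = I := by
    have hle : I.map (LinearMap.mulLeft F x) ≤ I := by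
      rintro _ ⟨y, -, rfl⟩
      exact hI.mul_mem x hx.1 y
    refine hle.eq_of_not_lt fun hlt => hxz ?_
    have := hbot _ (hI.map_mulLeft hgr hx.2) hlt
    have hmem := Submodule.mem_map_of_mem (f := LinearMap.mulLeft F x) hzI
    rwa [this, Submodule.mem_bot] at hmem
  have hker : I ⊓ LinearMap.ker (LinearMap.mulLeft F x) = ⊥ := by
    refine hbot _ (hI.inf_ker_mulLeft hgr hx.2) (inf_le_left.lt_of_ne fun h => hxz ?_)
    exact (inf_eq_left.1 h) hzI
  obtain ⟨y, hyI, hy1, hxy⟩ := hI.exists_right_unit hgr hx.2 (hmap.symm ▸ hx.1)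
  refine ⟨y, hIR hyI, hy1, ?_, ?_⟩
  · rintro rfl
    exact hxz (by rw [← hxy, mul_zero, zero_mul])
  · have hmem : y * y - y ∈ I ⊓ LinearMap.ker (LinearMap.mulLeft F x) :=
      ⟨sub_mem (hI.mul_mem y hyI y) hyI, by simp [mul_sub, ← mul_assoc, hxy]⟩
    rw [hker, Submodule.mem_bot] at hmem
    exact sub_eq_zero.1 hmem

theorem exists_left_unit_of_gradedJacobson_eq_bot {𝒜 : G → Submodule F A}
    (hgr : IsAlgebraGrading F G A 𝒜) [FiniteDimensional F A]
    (hJ : gradedJacobson F G A 𝒜 = ⊥) : ∃ f ∈ 𝒜 1, ∀ a : A, f * a = a := by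
  obtain ⟨f, ⟨hf1, hff⟩, hmin⟩ := (InvImage.wf
    (fun f : A => LinearMap.ker (LinearMap.mulLeft F f)) wellFounded_lt).has_min
    {f : A | f ∈ 𝒜 1 ∧ f * f = f} ⟨0, zero_mem _, mul_zero 0⟩
  have hker : LinearMap.ker (LinearMap.mulLeft F f) = ⊥ := by
    by_contra hne
    have hR := (IsGradedRightIdeal.top hgr.2.1).inf_ker_mulLeft hgr hf1
    rw [top_inf_eq] at hR
    obtain ⟨g, hg, hg1, hg0, hgg⟩ := hR.exists_idempotent hgr hJ hne
    have hfg : f * g = 0 := hg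
    have hgf1 : g * f ∈ 𝒜 1 := by simpa using hgr.2.2 hg1 hf1
    have hfk : f * (f + g - g * f) = f := by
      simp [mul_sub, mul_add, hff, hfg, ← mul_assoc]
    have hgk : g * (f + g - g * f) = g := by
      simp [mul_sub, mul_add, hgg, ← mul_assoc]
    have hkg : (f + g - g * f) * g = g := by
      simp [sub_mul, add_mul, hfg, hgg, mul_assoc]
    refine hmin (f + g - g * f) ⟨sub_mem (add_mem hf1 hg1) hgf1, ?_⟩ ?_
    · rw [sub_mul, add_mul, mul_assoc g f, hfk, hgk]
    · refine lt_of_le_of_ne (fun a ha => ?_) fun h => hg0 ?_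
      · have ha : (f + g - g * f) * a = 0 := ha
        have : f * a = 0 := by rw [← hfk, mul_assoc, ha, mul_zero]
        exact this
      · have : g ∈ LinearMap.ker (LinearMap.mulLeft F (f + g - g * f)) :=
          h.ge hg
        exact hkg.symm.trans this
  refine ⟨f, hf1, fun a => ?_⟩
  have hmem : f * a - a ∈ LinearMap.ker (LinearMap.mulLeft F f) := by
    simp [mul_sub, ← mul_assoc, hff]
  rw [hker, Submodule.mem_bot] at hmem
  exact sub_eq_zero.1 hmem

theorem gradedJacobson_eq_bot_implies_unital (𝒜 : G → Submodule F A)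
    (hgr : IsAlgebraGrading F G A 𝒜) [FiniteDimensional F A]
    (hJ : gradedJacobson F G A 𝒜 = ⊥) :
    ∃ u : A, ∀ a : A, u * a = a ∧ a * u = a := by
  obtain ⟨f, hf1, hf⟩ := exists_left_unit_of_gradedJacobson_eq_bot hgr hJ
  have hmul : ∀ x ∈ LinearMap.ker (LinearMap.mulRight F f), ∀ a : A, x * a = 0 := by
    intro x hx a
    have hx : x * f = 0 := hx
    rw [← hf a, ← mul_assoc, hx, zero_mul]
  have hL : IsGradedRightIdeal 𝒜 (LinearMap.ker (LinearMap.mulRight F f)) := by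
    refine ⟨fun x hx a => by rw [hmul x hx a]; exact zero_mem _, ?_⟩
    simpa using inf_ker_le_iSup_of_homogeneous hgr.1 (IsGradedRightIdeal.top hgr.2.1).le_iSup
      (LinearMap.mulRight F f) (mul_left_injective (1 : G)) fun _ _ hx => hgr.2.2 hx hf1
  have hbot := le_bot_iff.1 (hJ ▸ hL.le_gradedJacobson fun x hx y _ => hmul x hx y)
  refine ⟨f, fun a => ⟨hf a, ?_⟩⟩
  have hmem : a * f - a ∈ LinearMap.ker (LinearMap.mulRight F f) := by
    simp [sub_mul, mul_assoc, hf f]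
  rw [hbot, Submodule.mem_bot] at hmem
  exact sub_eq_zero.1 hmem
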